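/- arXiv:2006.14908 — 2 statements merged into one kernel-verified Lean document; each statement's English description precedes it below -/
import Mathlib

section
/- Let n and k be integers with k ≥ 1 and n ≥ 2k. Then there exist a set A ⊆ ℂ of n distinct points, a point x ∈ ℂ \ A, and a natural number N with N ≥ (n/k)^{k−1} (as reals), together with N pairwise non-homotopic x-loops in the complement of A such that none of them passes through x, each has fewer than k self-intersections, and every pair of them cross fewer than k times. -/
open unitInterval

/-- `γ` does not pass through `x` : its interior avoids the basepoint. -/
def AvoidsBase {A : Set ℂ} {x : ℂ} {hx : x ∉ A}
    (γ : Path (X := {z : ℂ // z ∉ A}) ⟨x, hx⟩ ⟨x, hx⟩) : Prop :=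
  ∀ t : I, t ≠ 0 → t ≠ 1 → (γ t : ℂ) ≠ x

/-- `γ` has fewer than `k` self-intersections: the set
`{(s,t) : 0 < s < t < 1, γ s = γ t}` has fewer than `k` elements. -/
def SelfIntersLt {A : Set ℂ} {x : ℂ} {hx : x ∉ A}
    (γ : Path (X := {z : ℂ // z ∉ A}) ⟨x, hx⟩ ⟨x, hx⟩) (k : ℕ) : Prop :=
  {p : I × I | p.1 ≠ 0 ∧ p.2 ≠ 1 ∧ p.1 < p.2 ∧ γ p.1 = γ p.2}.encard < (k : ℕ∞)

/-- `γ` and `γ'` cross fewer than `k` times: the set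
`{(s,t) ∈ (0,1)² : γ s = γ' t}` has fewer than `k` elements. -/
def CrossingsLt {A : Set ℂ} {x : ℂ} {hx : x ∉ A}
    (γ γ' : Path (X := {z : ℂ // z ∉ A}) ⟨x, hx⟩ ⟨x, hx⟩) (k : ℕ) : Prop :=
  {p : I × I | p.1 ≠ 0 ∧ p.1 ≠ 1 ∧ p.2 ≠ 0 ∧ p.2 ≠ 1 ∧ γ p.1 = γ' p.2}.encard < (k : ℕ∞)

/-- If two paths are homotopic, then logarithms of their images in the punctured plane
that start at the same value also end at the same value. -/
theorem Path.Homotopic.log_apply_one_eq {X : Type*} [TopologicalSpace X] {x y : X}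
    {γ₀ γ₁ : Path x y} (h : γ₀.Homotopic γ₁) {f : X → ℂ} (hf : Continuous f)
    (hf0 : ∀ z, f z ≠ 0) {L₀ L₁ : I → ℂ} (hL₀ : Continuous L₀) (hL₁ : Continuous L₁)
    (he₀ : ∀ t, Complex.exp (L₀ t) = f (γ₀ t)) (he₁ : ∀ t, Complex.exp (L₁ t) = f (γ₁ t))
    (h0 : L₀ 0 = L₁ 0) : L₀ 1 = L₁ 1 := by
  have cov := Complex.isCoveringMap_exp
  let F : C(X, {z : ℂ // z ≠ 0}) := ⟨fun z => ⟨f z, hf0 z⟩, by fun_prop⟩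
  obtain ⟨H⟩ := h
  have hF : (F.comp γ₀.toContinuousMap).HomotopicRel (F.comp γ₁.toContinuousMap) {0, 1} :=
    ⟨H.compContinuousMap F⟩
  have s₀ : (F.comp γ₀.toContinuousMap) 0 = ⟨_, (L₀ 0).exp_ne_zero⟩ :=
    Subtype.ext (he₀ 0).symm
  have s₁ : (F.comp γ₁.toContinuousMap) 0 = ⟨_, (L₀ 0).exp_ne_zero⟩ :=
    Subtype.ext (by rw [h0]; exact (he₁ 0).symm)
  have key := cov.liftPath_apply_one_eq_of_homotopicRel hF (L₀ 0) s₀ s₁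
  have e₀ := (cov.eq_liftPath_iff s₀ (Γ := L₀)).2
    ⟨hL₀, funext fun t => Subtype.ext (he₀ t), rfl⟩
  have e₁ := (cov.eq_liftPath_iff s₁ (Γ := L₁)).2
    ⟨hL₁, funext fun t => Subtype.ext (he₁ t), h0.symm⟩
  rw [congrFun e₀ 1, congrFun e₁ 1]
  exact key

/-- An increasing homeomorphism from `(0, 1)` to the real line. -/
noncomputable def stretch (t : ℝ) : ℝ := (2 * t - 1) / (t * (1 - t))

theorem mul_one_sub_pos {t : ℝ} (ht : t ∈ Set.Ioo (0 : ℝ) 1) : 0 < t * (1 - t) :=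
  mul_pos ht.1 (sub_pos.2 ht.2)

theorem stretch_injOn : Set.InjOn stretch (Set.Ioo 0 1) := by
  intro s hs t ht h
  have h1 := mul_one_sub_pos hs
  have h2 := mul_one_sub_pos ht
  unfold stretch at h
  rw [div_eq_div_iff h1.ne' h2.ne'] at h
  have h3 : (s - t) * ((1 - s) * (1 - t) + s * t) = 0 := by linear_combination h
  have h4 : 0 < (1 - s) * (1 - t) + s * t :=
    add_pos (mul_pos (sub_pos.2 hs.2) (sub_pos.2 ht.2)) (mul_pos hs.1 ht.1)
  exact sub_eq_zero.1 ((mul_eq_zero.1 h3).resolve_right h4.ne')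

/-- The denominator of `graphLoop`. -/
noncomputable def graphDen (P : ℝ → ℝ) (t : ℝ) : ℂ := ⟨2 * t - 1, t * (1 - t) * P t⟩

/-- The inverse of the graph `t ↦ stretch t + i P t`, closed up at the ends by the value `0`. -/
noncomputable def graphLoop (P : ℝ → ℝ) (t : ℝ) : ℂ := ((t * (1 - t) : ℝ) : ℂ) / graphDen P t

theorem graphDen_ne_zero {P : ℝ → ℝ} (hP : 0 < P (1 / 2)) (t : ℝ) : graphDen P t ≠ 0 := by
  intro h
  have hre : 2 * t - 1 = 0 := congrArg Complex.re h
  have him : t * (1 - t) * P t = 0 := congrArg Complex.im h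
  obtain rfl : t = 1 / 2 := by linarith
  linarith

theorem continuous_graphDen {P : ℝ → ℝ} (hc : Continuous P) : Continuous (graphDen P) := by
  have : graphDen P = fun t : ℝ =>
      ((2 * t - 1 : ℝ) : ℂ) + ((t * (1 - t) * P t : ℝ) : ℂ) * Complex.I :=
    funext fun t => Complex.mk_eq_add_mul_I _ _
  rw [this]
  fun_prop

theorem continuous_graphLoop {P : ℝ → ℝ} (hc : Continuous P) (hP : 0 < P (1 / 2)) :
    Continuous (graphLoop P) :=
  Continuous.div (by fun_prop) (continuous_graphDen hc) (graphDen_ne_zero hP)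

theorem graphLoop_zero (P : ℝ → ℝ) : graphLoop P 0 = 0 := by simp [graphLoop]

theorem graphLoop_one (P : ℝ → ℝ) : graphLoop P 1 = 0 := by simp [graphLoop]

theorem inv_graphLoop (P : ℝ → ℝ) {t : ℝ} (ht : t ∈ Set.Ioo (0 : ℝ) 1) :
    (graphLoop P t)⁻¹ = ⟨stretch t, P t⟩ := by
  have h := (mul_one_sub_pos ht).ne'
  rw [graphLoop, inv_div]
  apply Complex.ext
  · rw [Complex.div_ofReal_re]; rfl
  · rw [Complex.div_ofReal_im]
    exact mul_div_cancel_left₀ _ h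

theorem graphLoop_eq_iff {P Q : ℝ → ℝ} {s t : ℝ} (hs : s ∈ Set.Ioo (0 : ℝ) 1)
    (ht : t ∈ Set.Ioo (0 : ℝ) 1) : graphLoop P s = graphLoop Q t ↔ s = t ∧ P s = Q t := by
  rw [← inv_inj, inv_graphLoop P hs, inv_graphLoop Q ht, Complex.mk.injEq]
  refine and_congr_left fun _ => stretch_injOn.eq_iff hs ht

theorem graphLoop_ne_zero {P : ℝ → ℝ} (hP : 0 < P (1 / 2)) {t : ℝ}
    (ht : t ∈ Set.Ioo (0 : ℝ) 1) : graphLoop P t ≠ 0 :=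
  div_ne_zero (Complex.ofReal_ne_zero.2 (mul_one_sub_pos ht).ne') (graphDen_ne_zero hP t)

theorem inv_mk_stretch_ne_zero {τ q : ℝ} (hq : q ≠ 0) : (⟨stretch τ, q⟩ : ℂ)⁻¹ ≠ 0 :=
  inv_ne_zero fun h => hq (congrArg Complex.im h)

theorem graphLoop_ne_inv {P : ℝ → ℝ} {t τ q : ℝ} (ht : t ∈ Set.Icc (0 : ℝ) 1)
    (hτ : τ ∈ Set.Ioo (0 : ℝ) 1) (hq : q ≠ 0) (h : P τ ≠ q) :
    graphLoop P t ≠ (⟨stretch τ, q⟩ : ℂ)⁻¹ := by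
  intro he
  rcases ht.1.eq_or_lt with rfl | h0
  · exact inv_mk_stretch_ne_zero hq (he.symm.trans (graphLoop_zero P))
  rcases ht.2.eq_or_lt with rfl | h1
  · exact inv_mk_stretch_ne_zero hq (he.symm.trans (graphLoop_one P))
  rw [← inv_inj, inv_inv, inv_graphLoop P ⟨h0, h1⟩, Complex.mk.injEq] at he
  obtain rfl := stretch_injOn ⟨h0, h1⟩ hτ he.1
  exact h he.2

/-- The numerator of `1 - graphLoop P t * (stretch τ + i q)`. -/
noncomputable def graphNum (P : ℝ → ℝ) (τ q t : ℝ) : ℂ :=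
  ⟨2 * t - 1 - t * (1 - t) * stretch τ, t * (1 - t) * (P t - q)⟩

theorem continuous_graphNum {P : ℝ → ℝ} (hc : Continuous P) (τ q : ℝ) :
    Continuous (graphNum P τ q) := by
  have : graphNum P τ q = fun t : ℝ => ((2 * t - 1 - t * (1 - t) * stretch τ : ℝ) : ℂ) +
      ((t * (1 - t) * (P t - q) : ℝ) : ℂ) * Complex.I :=
    funext fun t => Complex.mk_eq_add_mul_I _ _
  rw [this]
  fun_prop

theorem neg_graphNum_div_graphDen {P : ℝ → ℝ} (hP : 0 < P (1 / 2)) (τ q t : ℝ) :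
    -graphNum P τ q t / graphDen P t = graphLoop P t * ⟨stretch τ, q⟩ - 1 := by
  have h := graphDen_ne_zero hP t
  rw [graphLoop, div_mul_eq_mul_div, div_eq_iff h, sub_mul, div_mul_cancel₀ _ h]
  apply Complex.ext
  · simp [graphNum, graphDen]
  · simp [graphNum, graphDen]
    ring

theorem eq_of_graphNum_re_eq_zero {P : ℝ → ℝ} {τ q t : ℝ} (ht : t ∈ Set.Icc (0 : ℝ) 1)
    (hτ : τ ∈ Set.Ioo (0 : ℝ) 1) (h : (graphNum P τ q t).re = 0) : t = τ := by
  change 2 * t - 1 - t * (1 - t) * stretch τ = 0 at h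
  rcases ht.1.eq_or_lt with rfl | h0
  · norm_num at h
  rcases ht.2.eq_or_lt with rfl | h1
  · norm_num at h
  refine stretch_injOn ⟨h0, h1⟩ hτ ?_
  have h2 := mul_one_sub_pos ⟨h0, h1⟩
  change (2 * t - 1) / (t * (1 - t)) = stretch τ
  rw [div_eq_iff h2.ne']
  linarith

theorem neg_I_mul_graphDen_mem_slitPlane {P : ℝ → ℝ} (hP : 0 < P (1 / 2)) (t : ℝ) :
    -Complex.I * graphDen P t ∈ Complex.slitPlane := by
  rw [Complex.mem_slitPlane_iff]
  by_cases h : 2 * t - 1 = 0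
  · left
    obtain rfl : t = 1 / 2 := by linarith
    simp only [graphDen, Complex.mul_re, Complex.neg_re, Complex.neg_im, Complex.I_re,
      Complex.I_im]
    linarith
  · right
    rw [neg_mul, Complex.neg_im, Complex.I_mul_im]
    exact neg_ne_zero.2 h

theorem neg_I_mul_graphNum_mem_slitPlane {P : ℝ → ℝ} {τ q t : ℝ} (ht : t ∈ Set.Icc (0 : ℝ) 1)
    (hτ : τ ∈ Set.Ioo (0 : ℝ) 1) (h : q < P τ) :
    -Complex.I * graphNum P τ q t ∈ Complex.slitPlane := by
  rw [Complex.mem_slitPlane_iff]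
  by_cases h0 : (graphNum P τ q t).re = 0
  · left
    obtain rfl := eq_of_graphNum_re_eq_zero ht hτ h0
    simpa [graphNum] using mul_pos (mul_one_sub_pos hτ) (sub_pos.2 h)
  · right
    simpa using h0

theorem I_mul_graphNum_mem_slitPlane {P : ℝ → ℝ} {τ q t : ℝ} (ht : t ∈ Set.Icc (0 : ℝ) 1)
    (hτ : τ ∈ Set.Ioo (0 : ℝ) 1) (h : P τ < q) :
    Complex.I * graphNum P τ q t ∈ Complex.slitPlane := by
  rw [Complex.mem_slitPlane_iff]
  by_cases h0 : (graphNum P τ q t).re = 0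
  · left
    obtain rfl := eq_of_graphNum_re_eq_zero ht hτ h0
    simpa [graphNum] using mul_neg_of_pos_of_neg (mul_one_sub_pos hτ) (sub_neg.2 h)
  · right
    simpa using h0

theorem graphDen_zero (P : ℝ → ℝ) : graphDen P 0 = -1 := by
  apply Complex.ext <;> simp [graphDen]

theorem graphDen_one (P : ℝ → ℝ) : graphDen P 1 = 1 := by
  apply Complex.ext <;> norm_num [graphDen]

theorem graphNum_zero (P : ℝ → ℝ) (τ q : ℝ) : graphNum P τ q 0 = -1 := by
  apply Complex.ext <;> simp [graphNum]

theorem graphNum_one (P : ℝ → ℝ) (τ q : ℝ) : graphNum P τ q 1 = 1 := by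
  apply Complex.ext <;> norm_num [graphNum]

/-- Two loops given by graphs that pass on different sides of a puncture are not homotopic. -/
theorem not_homotopic_of_separated {A : Set ℂ} {hx : (0 : ℂ) ∉ A} {P Q : ℝ → ℝ} {τ q : ℝ}
    {γ γ' : Path (X := {z : ℂ // z ∉ A}) ⟨0, hx⟩ ⟨0, hx⟩}
    (hγ : ∀ t : I, (γ t : ℂ) = graphLoop P t) (hγ' : ∀ t : I, (γ' t : ℂ) = graphLoop Q t)
    (hPc : Continuous P) (hQc : Continuous Q) (hP : 0 < P (1 / 2)) (hQ : 0 < Q (1 / 2))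
    (hτ : τ ∈ Set.Ioo (0 : ℝ) 1) (hA : (⟨stretch τ, q⟩ : ℂ)⁻¹ ∈ A)
    (hPq : P τ < q) (hQq : q < Q τ) : ¬ γ.Homotopic γ' := by
  intro h
  let w : ℂ := ⟨stretch τ, q⟩
  have hf0 : ∀ z : {z : ℂ // z ∉ A}, (z : ℂ) * w - 1 ≠ 0 := fun z hz =>
    z.2 (eq_inv_of_mul_eq_one_left (sub_eq_zero.1 hz) ▸ hA)
  let L₀ : I → ℂ := fun t => Complex.log (Complex.I * graphNum P τ q t) -
    Complex.log (-Complex.I * graphDen P t) + 2 * Real.pi * Complex.I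
  let L₁ : I → ℂ := fun t => Complex.log (-Complex.I * graphNum Q τ q t) -
    Complex.log (-Complex.I * graphDen Q t) + Real.pi * Complex.I
  have hDc := fun {R : ℝ → ℝ} (hR : Continuous R) =>
    (continuous_graphDen hR).comp (continuous_subtype_val (p := (· ∈ I)))
  have hNc := fun {R : ℝ → ℝ} (hR : Continuous R) =>
    (continuous_graphNum hR τ q).comp (continuous_subtype_val (p := (· ∈ I)))
  have hL₀ : Continuous L₀ :=
    (((continuous_const.mul (hNc hPc)).clog fun t =>
      I_mul_graphNum_mem_slitPlane t.2 hτ hPq).sub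
      ((continuous_const.mul (hDc hPc)).clog fun t =>
        neg_I_mul_graphDen_mem_slitPlane hP t)).add continuous_const
  have hL₁ : Continuous L₁ :=
    (((continuous_const.mul (hNc hQc)).clog fun t =>
      neg_I_mul_graphNum_mem_slitPlane t.2 hτ hQq).sub
      ((continuous_const.mul (hDc hQc)).clog fun t =>
        neg_I_mul_graphDen_mem_slitPlane hQ t)).add continuous_const
  have he₀ : ∀ t, Complex.exp (L₀ t) = (γ t : ℂ) * w - 1 := fun t => by
    rw [hγ, ← neg_graphNum_div_graphDen hP, Complex.exp_add, Complex.exp_two_pi_mul_I,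
      Complex.exp_sub,
      Complex.exp_log (Complex.slitPlane_ne_zero (I_mul_graphNum_mem_slitPlane t.2 hτ hPq)),
      Complex.exp_log (Complex.slitPlane_ne_zero (neg_I_mul_graphDen_mem_slitPlane hP t)),
      mul_one, neg_mul, ← mul_neg, mul_div_mul_left _ _ Complex.I_ne_zero, div_neg, neg_div]
  have he₁ : ∀ t, Complex.exp (L₁ t) = (γ' t : ℂ) * w - 1 := fun t => by
    rw [hγ', ← neg_graphNum_div_graphDen hQ, Complex.exp_add, Complex.exp_pi_mul_I,
      Complex.exp_sub,
      Complex.exp_log (Complex.slitPlane_ne_zero (neg_I_mul_graphNum_mem_slitPlane t.2 hτ hQq)),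
      Complex.exp_log (Complex.slitPlane_ne_zero (neg_I_mul_graphDen_mem_slitPlane hQ t)),
      mul_neg_one, mul_div_mul_left _ _ (neg_ne_zero.2 Complex.I_ne_zero), neg_div]
  have h1 := h.log_apply_one_eq (f := fun z => (z : ℂ) * w - 1) (by fun_prop) hf0 hL₀ hL₁
    he₀ he₁ (by
      simp only [L₀, L₁, Set.Icc.coe_zero, graphNum_zero, graphDen_zero, mul_neg_one, neg_neg,
        Complex.log_I, Complex.log_neg_I]
      ring)
  simp only [L₀, L₁, Set.Icc.coe_one, graphNum_one, graphDen_one, mul_one,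
    Complex.log_I, Complex.log_neg_I] at h1
  have h2 : (2 * Real.pi : ℂ) * Complex.I = 0 := by linear_combination h1
  exact Complex.two_pi_I_ne_zero h2

theorem coe_mem_Ioo {t : I} (h0 : t ≠ 0) (h1 : t ≠ 1) : (t : ℝ) ∈ Set.Ioo (0 : ℝ) 1 :=
  ⟨unitInterval.pos_iff_ne_zero.2 h0, unitInterval.lt_one_iff_ne_one.2 h1⟩

section GraphPath

variable {A : Set ℂ} {hx : (0 : ℂ) ∉ A} {P : ℝ → ℝ}
  {γ γ' : Path (X := {z : ℂ // z ∉ A}) ⟨0, hx⟩ ⟨0, hx⟩}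

theorem avoidsBase_of_graphLoop (hγ : ∀ t : I, (γ t : ℂ) = graphLoop P t)
    (hP : 0 < P (1 / 2)) : AvoidsBase γ := fun t h0 h1 =>
  hγ t ▸ graphLoop_ne_zero hP (coe_mem_Ioo h0 h1)

theorem selfIntersLt_of_graphLoop (hγ : ∀ t : I, (γ t : ℂ) = graphLoop P t) {k : ℕ}
    (hk : 1 ≤ k) : SelfIntersLt γ k := by
  have h : {p : I × I | p.1 ≠ 0 ∧ p.2 ≠ 1 ∧ p.1 < p.2 ∧ γ p.1 = γ p.2} = ∅ := by
    refine Set.eq_empty_of_forall_notMem fun p ⟨h0, h1, hlt, he⟩ => ?_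
    have he := congrArg Subtype.val he
    rw [hγ, hγ, graphLoop_eq_iff (coe_mem_Ioo h0 (hlt.trans_le unitInterval.le_one').ne)
      (coe_mem_Ioo (unitInterval.nonneg'.trans_lt hlt).ne' h1)] at he
    exact hlt.ne (Subtype.ext he.1)
  rw [SelfIntersLt, h, Set.encard_empty]
  exact_mod_cast hk

theorem crossingsLt_of_graphLoop {P Q : Polynomial ℝ} {k : ℕ} (hne : P ≠ Q)
    (hP : P.degree < k) (hQ : Q.degree < k)
    (hγ : ∀ t : I, (γ t : ℂ) = graphLoop (P.eval ·) t)
    (hγ' : ∀ t : I, (γ' t : ℂ) = graphLoop (Q.eval ·) t) : CrossingsLt γ γ' k := by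
  have hmem : ∀ p : I × I, p.1 ≠ 0 ∧ p.1 ≠ 1 ∧ p.2 ≠ 0 ∧ p.2 ≠ 1 ∧ γ p.1 = γ' p.2 →
      p.1 = p.2 ∧ (P - Q).eval (p.1 : ℝ) = 0 := by
    rintro p ⟨h0, h1, h0', h1', he⟩
    have he := congrArg Subtype.val he
    rw [hγ, hγ', graphLoop_eq_iff (coe_mem_Ioo h0 h1) (coe_mem_Ioo h0' h1')] at he
    refine ⟨Subtype.ext he.1, ?_⟩
    rw [Polynomial.eval_sub, he.2, ← he.1, sub_self]
  have hle : {p : I × I | p.1 ≠ 0 ∧ p.1 ≠ 1 ∧ p.2 ≠ 0 ∧ p.2 ≠ 1 ∧ γ p.1 = γ' p.2}.encard ≤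
      ((P - Q).roots.toFinset : Set ℝ).encard := by
    refine Set.encard_le_encard_of_injOn (f := fun p => (p.1 : ℝ)) (fun p hp => ?_)
      fun p hp p' hp' h => ?_
    · simpa [sub_ne_zero.2 hne, Polynomial.IsRoot] using (hmem p hp).2
    · have h1 : p.1 = p'.1 := Subtype.ext h
      exact Prod.ext h1 ((hmem p hp).1.symm.trans (h1.trans (hmem p' hp').1))
  refine hle.trans_lt ?_
  rw [Set.encard_coe_eq_coe_finsetCard, Nat.cast_lt]
  have hd : (P - Q).degree < k := (Polynomial.degree_sub_le P Q).trans_lt (max_lt hP hQ)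
  rw [Polynomial.degree_eq_natDegree (sub_ne_zero.2 hne), Nat.cast_lt] at hd
  exact ((Multiset.toFinset_card_le _).trans (Polynomial.card_roots' _)).trans_lt hd

end GraphPath

/-- Abscissae of the columns along which the punctures are arranged. -/
noncomputable def columnParam (j : ℕ) : ℝ := 1 / (j + 2)

theorem columnParam_mem_Ioo (j : ℕ) : columnParam j ∈ Set.Ioo (0 : ℝ) 1 := by
  unfold columnParam
  have : (0 : ℝ) ≤ j := j.cast_nonneg
  exact ⟨by positivity, (div_lt_one (by positivity)).2 (by linarith)⟩

theorem columnParam_injective : Function.Injective columnParam := by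
  intro i j h
  have h : (i : ℝ) + 2 = j + 2 := by simpa [columnParam] using h
  exact_mod_cast add_right_cancel h

/-- The `i`-th puncture, of height `i / k + 1` in column `i % k`. -/
noncomputable def puncture (k i : ℕ) : ℂ :=
  (⟨stretch (columnParam (i % k)), ((i / k + 1 : ℕ) : ℝ)⟩ : ℂ)⁻¹

theorem puncture_injective (k : ℕ) : Function.Injective (puncture k) := by
  intro i j h
  rw [puncture, puncture, inv_inj, Complex.mk.injEq] at h
  have h1 := columnParam_injective
    (stretch_injOn (columnParam_mem_Ioo _) (columnParam_mem_Ioo _) h.1)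
  have h2 : i / k = j / k := by simpa using h.2
  rw [← Nat.div_add_mod i k, ← Nat.div_add_mod j k, h1, h2]

/-- The polynomial passing through column `j` between the heights `l j` and `l j + 1`. -/
noncomputable def gapPoly {k : ℕ} (l : Fin k → ℕ) : Polynomial ℝ :=
  Lagrange.interpolate Finset.univ (fun j : Fin k => columnParam j) fun j => (l j : ℝ) + 1 / 2

theorem gapPoly_eval {k : ℕ} (l : Fin k → ℕ) (j : Fin k) :
    (gapPoly l).eval (columnParam j) = l j + 1 / 2 :=
  Lagrange.eval_interpolate_at_node _
    (columnParam_injective.comp Fin.val_injective).injOn (Finset.mem_univ j)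

theorem gapPoly_degree_lt {k : ℕ} (l : Fin k → ℕ) : (gapPoly l).degree < k := by
  have h := Lagrange.degree_interpolate_lt (s := Finset.univ)
    (v := fun j : Fin k => columnParam j) (fun j => (l j : ℝ) + 1 / 2)
    (columnParam_injective.comp Fin.val_injective).injOn
  rwa [Finset.card_fin] at h

theorem gapPoly_injective {k : ℕ} : Function.Injective (gapPoly (k := k)) := by
  intro l l' h
  ext j
  have := gapPoly_eval l j
  rw [h, gapPoly_eval] at this
  exact_mod_cast (add_right_cancel this).symm

theorem gapPoly_eval_half_pos {k : ℕ} (hk : 1 ≤ k) (l : Fin k → ℕ) :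
    0 < (gapPoly l).eval (1 / 2) := by
  have h := gapPoly_eval l ⟨0, hk⟩
  simp only [columnParam, Nat.cast_zero, zero_add] at h
  rw [h]
  positivity

theorem gapPoly_eval_ne_natCast {k : ℕ} (l : Fin k → ℕ) (j : Fin k) (m : ℕ) :
    (gapPoly l).eval (columnParam j) ≠ m := by
  rw [gapPoly_eval]
  intro h
  have h : 2 * l j + 1 = 2 * m := by
    have : (2 * l j + 1 : ℝ) = 2 * m := by linarith
    exact_mod_cast this
  omega

theorem div_pow_pred_le (n : ℕ) {k : ℕ} (hk : 1 ≤ k) :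
    ((n : ℝ) / k) ^ (k - 1) ≤ (((n / k + 1) ^ k : ℕ) : ℝ) := by
  have hk0 : (0 : ℝ) < k := by exact_mod_cast hk
  have h : (n : ℝ) / k ≤ ((n / k + 1 : ℕ) : ℝ) := by
    rw [div_le_iff₀ hk0, mul_comm]
    exact_mod_cast (Nat.lt_mul_div_succ n hk).le
  calc ((n : ℝ) / k) ^ (k - 1) ≤ ((n / k + 1 : ℕ) : ℝ) ^ (k - 1) :=
        pow_le_pow_left₀ (by positivity) h _
    _ ≤ ((n / k + 1 : ℕ) : ℝ) ^ k :=
        pow_le_pow_right₀ (by exact_mod_cast Nat.le_add_left 1 _) (Nat.sub_le k 1)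
    _ = _ := by push_cast; rfl

/-- (`f(n,k) ≥ (n/k)^{k-1}` for `n ≥ 2k`.) -/
theorem loops_lower_bound_large_n (n k : ℕ) (hk : 1 ≤ k) (hnk : 2 * k ≤ n) :
    ∃ (A : Set ℂ) (_ : A.Finite) (_ : A.ncard = n) (x : ℂ) (hx : x ∉ A) (N : ℕ)
      (γ : Fin N → Path (X := {z : ℂ // z ∉ A}) ⟨x, hx⟩ ⟨x, hx⟩),
      ((n : ℝ) / k) ^ (k - 1) ≤ (N : ℝ) ∧
      (∀ i j, i ≠ j → ¬ (γ i).Homotopic (γ j)) ∧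
      (∀ i, AvoidsBase (γ i)) ∧
      (∀ i, SelfIntersLt (γ i) k) ∧
      (∀ i j, i ≠ j → CrossingsLt (γ i) (γ j) k) := by
  have hk0 : 0 < k := hk
  set A : Set ℂ := puncture k '' Set.Iio n with hAdef
  have hx : (0 : ℂ) ∉ A := by
    rintro ⟨i, -, hi⟩
    exact inv_mk_stretch_ne_zero (Nat.cast_ne_zero.2 (i / k).succ_ne_zero) hi
  have hmem : ∀ (l : Fin k → ℕ) (t : I), graphLoop ((gapPoly l).eval ·) t ∉ A := by
    rintro l t ⟨i, -, hi⟩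
    exact graphLoop_ne_inv (P := ((gapPoly l).eval ·)) t.2 (columnParam_mem_Ioo (i % k))
      (Nat.cast_ne_zero.2 (i / k).succ_ne_zero)
      (gapPoly_eval_ne_natCast l ⟨i % k, Nat.mod_lt i hk0⟩ (i / k + 1)) hi.symm
  let Γ : (Fin k → ℕ) → Path (X := {z : ℂ // z ∉ A}) ⟨0, hx⟩ ⟨0, hx⟩ := fun l =>
    { toFun := fun t => ⟨graphLoop ((gapPoly l).eval ·) t, hmem l t⟩
      continuous_toFun := ((continuous_graphLoop (gapPoly l).continuous
        (gapPoly_eval_half_pos hk l)).comp continuous_subtype_val).subtype_mk _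
      source' := Subtype.ext (graphLoop_zero _)
      target' := Subtype.ext (graphLoop_one _) }
  have hΓ : ∀ l (t : I), (Γ l t : ℂ) = graphLoop ((gapPoly l).eval ·) t := fun _ _ => rfl
  have hsep : ∀ (l l' : Fin k → ℕ) (j : Fin k), l j < l' j → l' j ≤ n / k →
      ¬ (Γ l).Homotopic (Γ l') := by
    intro l l' j hlt hle
    have hmod : (k * l j + j) % k = j := by
      rw [Nat.mul_add_mod, Nat.mod_eq_of_lt j.2]
    have hdiv : (k * l j + j) / k = l j := by
      rw [Nat.mul_add_div hk0, Nat.div_eq_of_lt j.2, add_zero]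
    have hin : (⟨stretch (columnParam j), ((l j + 1 : ℕ) : ℝ)⟩ : ℂ)⁻¹ ∈ A := by
      refine ⟨k * l j + j, ?_, by rw [puncture, hmod, hdiv]⟩
      calc k * l j + j < k * l j + k := Nat.add_lt_add_left j.2 _
        _ = k * (l j + 1) := by ring
        _ ≤ k * (n / k) := Nat.mul_le_mul_left k (hlt.trans_le hle)
        _ ≤ n := Nat.mul_div_le n k
    refine not_homotopic_of_separated (hΓ l) (hΓ l') (gapPoly l).continuous
      (gapPoly l').continuous (gapPoly_eval_half_pos hk l) (gapPoly_eval_half_pos hk l')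
      (columnParam_mem_Ioo j) hin ?_ ?_
    · rw [gapPoly_eval]
      push_cast
      linarith
    · rw [gapPoly_eval]
      have : ((l j + 1 : ℕ) : ℝ) ≤ l' j := by exact_mod_cast hlt
      linarith
  let e : Fin ((n / k + 1) ^ k) → Fin k → ℕ := fun i j => finFunctionFinEquiv.symm i j
  have he : Function.Injective e := fun i i' h =>
    finFunctionFinEquiv.symm.injective (funext fun j => Fin.ext (congrFun h j))
  have hele : ∀ i j, e i j ≤ n / k := fun i j => Nat.lt_succ_iff.1 (Fin.is_lt _)
  refine ⟨A, (Set.finite_Iio n).image _, ?_, 0, hx, (n / k + 1) ^ k, fun i => Γ (e i),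
    div_pow_pred_le n hk, fun i i' hne => ?_,
    fun i => avoidsBase_of_graphLoop (hΓ _) (gapPoly_eval_half_pos hk _),
    fun i => selfIntersLt_of_graphLoop (hΓ _) hk,
    fun i i' hne => crossingsLt_of_graphLoop (gapPoly_injective.ne (he.ne hne))
      (gapPoly_degree_lt _) (gapPoly_degree_lt _) (hΓ _) (hΓ _)⟩
  · rw [hAdef, Set.ncard_image_of_injective _ (puncture_injective k), Set.ncard_eq_toFinset_card',
      Set.toFinset_Iio, Nat.card_Iio]
  · obtain ⟨j, hj⟩ := Function.ne_iff.1 (he.ne hne)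
    rcases hj.lt_or_gt with hlt | hlt
    · exact hsep _ _ j hlt (hele i' j)
    · exact fun h => hsep _ _ j hlt (hele i j) h.symm
end

section
/- Let n and k be integers with n ≥ 2 and 1 ≤ k ≤ n. Then there exist a set A ⊆ ℂ of n distinct points, a point x ∈ ℂ \ A, and a natural number N with N ≥ 2·∑_{j=0}^{k−1} C(n−1, j) (sum of binomial coefficients), together with N pairwise non-homotopic x-loops in the complement of A such that none of them passes through x, each has fewer than k self-intersections, and every pair of them cross fewer than k times. -/
open unitInterval

/-- Lifts through `exp` of homotopic loops have the same total increment. -/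
theorem exp_lift_increment_eq_of_homotopic {X : Type*} [TopologicalSpace X] {x y : X}
    {γ γ' : Path x y} (h : γ.Homotopic γ') (g : C(X, {z : ℂ // z ≠ 0})) {L L' : I → ℂ}
    (hL : Continuous L) (hL' : Continuous L') (e : ∀ t, Complex.exp (L t) = g (γ t))
    (e' : ∀ t, Complex.exp (L' t) = g (γ' t)) : L 1 - L 0 = L' 1 - L' 0 := by
  have cov := Complex.isCoveringMap_exp
  have h0 : ((γ.map g.continuous : Path _ _) : C(I, _)) 0 =
      (⟨Complex.exp (L 0), Complex.exp_ne_zero _⟩ : {z : ℂ // z ≠ 0}) :=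
    Subtype.ext (by simp [e])
  have h0' : ((γ'.map g.continuous : Path _ _) : C(I, _)) 0 =
      (⟨Complex.exp (L 0), Complex.exp_ne_zero _⟩ : {z : ℂ // z ≠ 0}) :=
    Subtype.ext (by simp [e])
  have key := cov.liftPath_apply_one_eq_of_homotopicRel (h.map g) (L 0) h0 h0'
  have hexp : Complex.exp (L 0 - L' 0) = 1 := by
    rw [Complex.exp_sub, e, e', γ.source, γ'.source]
    exact div_self (g x).2
  have h1 : L = cov.liftPath _ (L 0) h0 :=
    (cov.eq_liftPath_iff h0).2 ⟨hL, funext fun t => Subtype.ext (by simp [e]), rfl⟩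
  have h2 : (fun t => L' t + (L 0 - L' 0)) = cov.liftPath _ (L 0) h0' :=
    (cov.eq_liftPath_iff h0').2 ⟨by fun_prop, funext fun t => Subtype.ext (by
      simp [Complex.exp_add, e', hexp]), by simp⟩
  have h3 := congrFun h1 1
  have h4 := congrFun h2 1
  have h5 := h4.trans (key.symm.trans h3.symm)
  linear_combination -h5

theorem one_sub_exp_mem_slitPlane {v : ℂ} (h : v.im = 0 → v.re < 0)
    (h1 : -(2 * Real.pi) < v.im) (h2 : v.im < 2 * Real.pi) :
    1 - Complex.exp v ∈ Complex.slitPlane := by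
  rw [Complex.mem_slitPlane_iff]
  by_contra! hc
  obtain ⟨hre, him⟩ := hc
  simp only [Complex.sub_re, Complex.one_re, Complex.exp_re, Complex.sub_im, Complex.one_im,
    Complex.exp_im] at hre him
  have hs : Real.sin v.im = 0 := by
    have := (Real.exp_pos v.re).ne'
    simp_all
  have hcos : 0 < Real.cos v.im := by
    by_contra! hn
    nlinarith [Real.exp_pos v.re]
  have hv : v.im = 0 := by
    have hc1 : Real.cos v.im = 1 := by nlinarith [Real.sin_sq_add_cos_sq v.im]
    exact (Real.cos_eq_one_iff_of_lt_of_lt h1 h2).1 hc1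
  have := Real.exp_lt_one_iff.2 (h hv)
  rw [hv, Real.cos_zero] at hre
  linarith

/-- The curve with radius `exp (t (1 - t) p(t))` at angle `2πt`. -/
noncomputable def polarCurve (p : Polynomial ℝ) (t : ℝ) : ℂ :=
  Complex.exp ((t * (1 - t) * p.eval t : ℝ) + (2 * Real.pi * t : ℝ) * Complex.I)

theorem continuous_polarCurve (p : Polynomial ℝ) : Continuous (polarCurve p) := by
  unfold polarCurve
  fun_prop

theorem polarCurve_zero (p : Polynomial ℝ) : polarCurve p 0 = 1 := by simp [polarCurve]

theorem polarCurve_one (p : Polynomial ℝ) : polarCurve p 1 = 1 := by simp [polarCurve]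

theorem polarCurve_eq_iff {p q : Polynomial ℝ} {s t : ℝ} (h : |s - t| < 1) :
    polarCurve p s = polarCurve q t ↔ s = t ∧ s * (1 - s) * p.eval s = t * (1 - t) * q.eval t := by
  constructor
  · intro e
    obtain ⟨m, hm⟩ := Complex.exp_eq_exp_iff_exists_int.1 e
    have hre := congrArg Complex.re hm
    have him := congrArg Complex.im hm
    simp at hre him
    have hst : s - t = m := by
      have : (2 * Real.pi) * (s - t - m) = 0 := by linear_combination him
      have h2 := (mul_eq_zero.1 this).resolve_left Real.two_pi_pos.ne'
      linarith
    have hm0 : m = 0 := by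
      rw [hst] at h
      exact Int.abs_lt_one_iff.1 (by exact_mod_cast h)
    rw [hm0] at hst
    refine ⟨by simpa [sub_eq_zero] using hst, hre⟩
  · rintro ⟨rfl, h⟩
    simp [polarCurve, h]

theorem polarCurve_ne {p : Polynomial ℝ} {a : ℝ} (ha : a ∈ Set.Ioo (0 : ℝ) 1)
    (hp : p.eval a ≠ 0) {t : ℝ} (ht : t ∈ Set.Icc (0 : ℝ) 1) :
    polarCurve p t ≠ polarCurve 0 a := by
  obtain ⟨h1, h2⟩ := ha
  obtain ⟨h3, h4⟩ := ht
  intro h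
  obtain ⟨rfl, h⟩ := (polarCurve_eq_iff (abs_lt.2 ⟨by linarith, by linarith⟩)).1 h
  have : t * (1 - t) ≠ 0 := by nlinarith
  simp_all

/-- The loop traced by `polarCurve p` in the complement of `A`. -/
noncomputable def polarLoop (p : Polynomial ℝ) {A : Set ℂ} (hx : (1 : ℂ) ∉ A)
    (hA : ∀ t ∈ Set.Icc (0 : ℝ) 1, polarCurve p t ∉ A) :
    Path (X := {z : ℂ // z ∉ A}) ⟨1, hx⟩ ⟨1, hx⟩ where
  toFun t := ⟨polarCurve p t, hA t t.2⟩
  continuous_toFun := by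
    have := continuous_polarCurve p
    fun_prop
  source' := Subtype.ext (by simp [polarCurve_zero])
  target' := Subtype.ext (by simp [polarCurve_one])

theorem polarLoop_apply (p : Polynomial ℝ) {A : Set ℂ} (hx : (1 : ℂ) ∉ A)
    (hA : ∀ t ∈ Set.Icc (0 : ℝ) 1, polarCurve p t ∉ A) (t : I) :
    (polarLoop p hx hA t : ℂ) = polarCurve p t := rfl

theorem avoidsBase_polarLoop (p : Polynomial ℝ) {A : Set ℂ} (hx : (1 : ℂ) ∉ A)
    (hA : ∀ t ∈ Set.Icc (0 : ℝ) 1, polarCurve p t ∉ A) : AvoidsBase (polarLoop p hx hA) := by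
  intro t h0 h1
  have h0' : 0 < (t : ℝ) := unitInterval.pos_iff_ne_zero.2 h0
  have h1' : (t : ℝ) < 1 := unitInterval.lt_one_iff_ne_one.2 h1
  rw [polarLoop_apply, ← polarCurve_zero p, Ne, polarCurve_eq_iff
    (abs_lt.2 ⟨by linarith, by linarith⟩)]
  exact fun h => h0'.ne' h.1

theorem selfIntersLt_polarLoop (p : Polynomial ℝ) {A : Set ℂ} (hx : (1 : ℂ) ∉ A)
    (hA : ∀ t ∈ Set.Icc (0 : ℝ) 1, polarCurve p t ∉ A) {k : ℕ} (hk : 1 ≤ k) :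
    SelfIntersLt (polarLoop p hx hA) k := by
  unfold SelfIntersLt
  rw [Set.encard_eq_zero.2]
  · exact_mod_cast hk
  rw [Set.eq_empty_iff_forall_notMem]
  rintro ⟨s, t⟩ ⟨h0, h1, hlt, he⟩
  have h0' : 0 < (s : ℝ) := unitInterval.pos_iff_ne_zero.2 h0
  have h1' : (t : ℝ) < 1 := unitInterval.lt_one_iff_ne_one.2 h1
  have hlt' : (s : ℝ) < t := hlt
  have he' := congrArg Subtype.val he
  simp only [polarLoop_apply] at he'
  exact hlt'.ne ((polarCurve_eq_iff (abs_lt.2 ⟨by linarith, by linarith⟩)).1 he').1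

theorem crossingsLt_polarLoop {p q : Polynomial ℝ} (hpq : p ≠ q) {A : Set ℂ} (hx : (1 : ℂ) ∉ A)
    (hA : ∀ t ∈ Set.Icc (0 : ℝ) 1, polarCurve p t ∉ A)
    (hA' : ∀ t ∈ Set.Icc (0 : ℝ) 1, polarCurve q t ∉ A) {k : ℕ}
    (hp : p.natDegree < k) (hq : q.natDegree < k) :
    CrossingsLt (polarLoop p hx hA) (polarLoop q hx hA') k := by
  unfold CrossingsLt
  have hne : p - q ≠ 0 := sub_ne_zero.2 hpq
  have key : ∀ s t : I, s ≠ 0 → s ≠ 1 → t ≠ 0 → t ≠ 1 →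
      polarLoop p hx hA s = polarLoop q hx hA' t → s = t ∧ (p - q).IsRoot (s : ℝ) := by
    intro s t hs0 hs1 ht0 ht1 he
    have hs0' : 0 < (s : ℝ) := unitInterval.pos_iff_ne_zero.2 hs0
    have hs1' : (s : ℝ) < 1 := unitInterval.lt_one_iff_ne_one.2 hs1
    have ht0' : 0 < (t : ℝ) := unitInterval.pos_iff_ne_zero.2 ht0
    have ht1' : (t : ℝ) < 1 := unitInterval.lt_one_iff_ne_one.2 ht1
    have he' := congrArg Subtype.val he
    simp only [polarLoop_apply] at he'
    obtain ⟨hst, hv⟩ := (polarCurve_eq_iff (abs_lt.2 ⟨by linarith, by linarith⟩)).1 he'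
    refine ⟨Subtype.ext hst, ?_⟩
    rw [← hst] at hv
    have h0 : (s : ℝ) * (1 - s) ≠ 0 := by nlinarith
    simp [Polynomial.IsRoot, mul_left_cancel₀ h0 hv]
  calc _ ≤ ((p - q).roots.toFinset : Set ℝ).encard := by
        refine Set.encard_le_encard_of_injOn (f := fun r : I × I => (r.1 : ℝ)) ?_ ?_
        · rintro ⟨s, t⟩ ⟨h1, h2, h3, h4, h5⟩
          simpa [hne] using (key s t h1 h2 h3 h4 h5).2
        · rintro ⟨s, t⟩ ⟨h1, h2, h3, h4, h5⟩ ⟨s', t'⟩ ⟨h1', h2', h3', h4', h5'⟩ hs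
          have := (key s t h1 h2 h3 h4 h5).1
          have := (key s' t' h1' h2' h3' h4' h5').1
          have := Subtype.ext hs
          simp_all
    _ = ((p - q).roots.toFinset.card : ℕ∞) := Set.encard_coe_eq_coe_finsetCard _
    _ < k := by
        have h1 := (p - q).roots.toFinset_card_le
        have h2 := (p - q).card_roots'
        have h3 := Polynomial.natDegree_sub_le p q
        exact_mod_cast lt_of_le_of_lt (h1.trans (h2.trans h3)) (max_lt hp hq)

/-- The loops of two polynomials with opposite signs at `a` wind differently around the point at
angle `2πa` on the unit circle. -/
theorem not_homotopic_polarLoop {p q : Polynomial ℝ} {A : Set ℂ} (hx : (1 : ℂ) ∉ A)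
    (hA : ∀ t ∈ Set.Icc (0 : ℝ) 1, polarCurve p t ∉ A)
    (hA' : ∀ t ∈ Set.Icc (0 : ℝ) 1, polarCurve q t ∉ A) {a : ℝ} (ha : a ∈ Set.Ioo (0 : ℝ) 1)
    (haA : polarCurve 0 a ∈ A) (hp : p.eval a < 0) (hq : 0 < q.eval a) :
    ¬ (polarLoop p hx hA).Homotopic (polarLoop q hx hA') := by
  intro hom
  obtain ⟨ha0, ha1⟩ := ha
  have hb : polarCurve 0 a ≠ 0 := Complex.exp_ne_zero _
  let g : C({z : ℂ // z ∉ A}, {z : ℂ // z ≠ 0}) :=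
    ⟨fun z => ⟨1 - z / polarCurve 0 a, fun h => z.2 (by
      rw [sub_eq_zero, eq_comm, div_eq_one_iff_eq hb] at h
      rwa [h])⟩, by fun_prop⟩
  let v (r : Polynomial ℝ) (t : ℝ) : ℂ :=
    (t * (1 - t) * r.eval t : ℝ) + (2 * Real.pi * (t - a) : ℝ) * Complex.I
  have hv (r : Polynomial ℝ) : Continuous (v r) := by unfold v; fun_prop
  have hre (r : Polynomial ℝ) (t : ℝ) : (v r t).re = t * (1 - t) * r.eval t := by simp [v]
  have him (r : Polynomial ℝ) (t : ℝ) : (v r t).im = 2 * Real.pi * (t - a) := by simp [v]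
  have hdiv (r : Polynomial ℝ) (t : ℝ) :
      polarCurve r t / polarCurve 0 a = Complex.exp (v r t) := by
    unfold polarCurve
    rw [← Complex.exp_sub]
    congr 1
    simp [v]
    ring
  have hv1 (r : Polynomial ℝ) : v r 1 - v r 0 = 2 * Real.pi * Complex.I := by
    simp [v]
    ring
  have hexp (r : Polynomial ℝ) : Complex.exp (v r 1) = Complex.exp (v r 0) := by
    rw [← hdiv, ← hdiv, polarCurve_one, polarCurve_zero]
  have hpi := Real.pi_pos
  have hzero (r : Polynomial ℝ) (t : ℝ) (h : (v r t).im = 0) : t = a := by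
    rw [him] at h
    have := (mul_eq_zero.1 h).resolve_left Real.two_pi_pos.ne'
    linarith
  have haa : 0 < a * (1 - a) := mul_pos ha0 (by linarith)
  have sp (t : I) : 1 - Complex.exp (v p t) ∈ Complex.slitPlane := by
    have := t.2.1
    have := t.2.2
    refine one_sub_exp_mem_slitPlane (fun h => ?_) ?_ ?_
    · rw [hre, hzero p t h]
      exact mul_neg_of_pos_of_neg haa hp
    · rw [him]; nlinarith
    · rw [him]; nlinarith
  have sq (t : I) : 1 - Complex.exp (-v q t) ∈ Complex.slitPlane := by
    have := t.2.1
    have := t.2.2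
    refine one_sub_exp_mem_slitPlane (fun h => ?_) ?_ ?_
    · rw [Complex.neg_im, neg_eq_zero] at h
      rw [Complex.neg_re, hre, hzero q t h, neg_lt_zero]
      exact mul_pos haa hq
    · rw [Complex.neg_im, him]; nlinarith
    · rw [Complex.neg_im, him]; nlinarith
  have := hv p
  have := hv q
  have key := exp_lift_increment_eq_of_homotopic hom g
    (L := fun t => Complex.log (1 - Complex.exp (v p t)))
    (L' := fun t => Real.pi * Complex.I + v q t + Complex.log (1 - Complex.exp (-v q t)))
    (Continuous.clog (by fun_prop) sp)
    ((by fun_prop : Continuous fun t : I => Real.pi * Complex.I + v q t).add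
      (Continuous.clog (by fun_prop) sq))
    (fun t => by
      rw [Complex.exp_log (Complex.slitPlane_ne_zero (sp t)), ← hdiv]
      rfl)
    (fun t => by
      have h1 : ((g (polarLoop q hx hA' t) : {z : ℂ // z ≠ 0}) : ℂ) =
        1 - polarCurve q t / polarCurve 0 a := rfl
      rw [h1, hdiv, Complex.exp_add, Complex.exp_add, Complex.exp_pi_mul_I,
        Complex.exp_log (Complex.slitPlane_ne_zero (sq t)), Complex.exp_neg]
      have := Complex.exp_ne_zero (v q t)
      field_simp
      ring)
  simp only [Set.Icc.coe_zero, Set.Icc.coe_one, Complex.exp_neg, hexp, sub_self] at key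
  refine Complex.two_pi_I_ne_zero ?_
  rw [← hv1 q]
  linear_combination -key

/-- The polynomial of sign `ε` with a simple root between the consecutive nodes `(j + 1) / (n + 1)`
and `(j + 2) / (n + 1)` for each `j ∈ S`. -/
noncomputable def gapPolynomial (n : ℕ) (ε : ℝ) (S : Finset ℕ) : Polynomial ℝ :=
  Polynomial.C ε * ∏ j ∈ S, (Polynomial.C (n + 1 : ℝ) * Polynomial.X - Polynomial.C (j + 3 / 2 : ℝ))

theorem natDegree_gapPolynomial_le (n : ℕ) (ε : ℝ) (S : Finset ℕ) :
    (gapPolynomial n ε S).natDegree ≤ S.card := by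
  refine (Polynomial.natDegree_C_mul_le _ _).trans ((Polynomial.natDegree_prod_le _ _).trans ?_)
  rw [Finset.card_eq_sum_ones]
  refine Finset.sum_le_sum fun j _ => ?_
  compute_degree

theorem eval_gapPolynomial_node (n : ℕ) (ε : ℝ) (S : Finset ℕ) (i : ℕ) :
    (gapPolynomial n ε S).eval ((i + 1) / (n + 1) : ℝ) = ε * ∏ j ∈ S, ((i : ℝ) - j - 1 / 2) := by
  have : (n + 1 : ℝ) ≠ 0 := by positivity
  simp only [gapPolynomial, Polynomial.eval_mul, Polynomial.eval_C, Polynomial.eval_prod,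
    Polynomial.eval_sub, Polynomial.eval_X]
  congr 1
  refine Finset.prod_congr rfl fun j _ => ?_
  field_simp
  ring

theorem natCast_sub_sub_half_ne_zero (i j : ℕ) : (i : ℝ) - j - 1 / 2 ≠ 0 := by
  intro h
  have : (2 * i : ℝ) = 2 * j + 1 := by linarith
  norm_cast at this
  omega

theorem eval_gapPolynomial_node_ne_zero (n : ℕ) {ε : ℝ} (hε : ε ≠ 0) (S : Finset ℕ) (i : ℕ) :
    (gapPolynomial n ε S).eval ((i + 1) / (n + 1) : ℝ) ≠ 0 := by
  rw [eval_gapPolynomial_node]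
  exact mul_ne_zero hε (Finset.prod_ne_zero_iff.2 fun j _ => natCast_sub_sub_half_ne_zero i j)

theorem mem_iff_eval_gapPolynomial_mul_neg (n : ℕ) {ε : ℝ} (hε : ε ≠ 0) (S : Finset ℕ) (i : ℕ) :
    i ∈ S ↔ (gapPolynomial n ε S).eval ((i + 1) / (n + 1) : ℝ) *
      (gapPolynomial n ε S).eval (((i + 1 : ℕ) + 1) / (n + 1) : ℝ) < 0 := by
  have hfac (T : Finset ℕ) (hT : i ∉ T) :
      0 < ∏ j ∈ T, (((i : ℝ) - j - 1 / 2) * (((i + 1 : ℕ) : ℝ) - j - 1 / 2)) := by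
    refine Finset.prod_pos fun j hj => ?_
    have hij : i ≠ j := fun h => hT (h ▸ hj)
    have h1 : (1 : ℝ) ≤ ((i : ℝ) - j) ^ 2 := by
      have : (1 : ℤ) ≤ ((i : ℤ) - j) ^ 2 := Int.add_one_le_iff.2 (by
        have : (i : ℤ) - j ≠ 0 := by omega
        exact sq_pos_of_ne_zero this)
      exact_mod_cast this
    push_cast
    nlinarith
  have hε2 : 0 < ε * ε := mul_self_pos.2 hε
  rw [eval_gapPolynomial_node, eval_gapPolynomial_node, mul_mul_mul_comm,
    ← Finset.prod_mul_distrib]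
  constructor
  · intro hi
    rw [← Finset.mul_prod_erase S _ hi]
    refine mul_neg_of_pos_of_neg hε2 (mul_neg_of_neg_of_pos ?_ (hfac _ (Finset.notMem_erase i S)))
    push_cast
    nlinarith
  · intro h
    by_contra hi
    exact h.not_gt (mul_pos hε2 (hfac S hi))

/-- A gap polynomial is determined by its signs at the nodes. -/
theorem exists_node_eval_mul_neg {n : ℕ} (hn : 0 < n) {ε τ : ℝ} (hε : ε = 1 ∨ ε = -1)
    (hτ : τ = 1 ∨ τ = -1) {S T : Finset ℕ} (hS : S ⊆ Finset.range (n - 1))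
    (hT : T ⊆ Finset.range (n - 1)) (h : (ε, S) ≠ (τ, T)) :
    ∃ i < n, (gapPolynomial n ε S).eval ((i + 1) / (n + 1) : ℝ) *
      (gapPolynomial n τ T).eval ((i + 1) / (n + 1) : ℝ) < 0 := by
  by_contra! hc
  have hε0 : ε ≠ 0 := by rcases hε with rfl | rfl <;> norm_num
  have hτ0 : τ ≠ 0 := by rcases hτ with rfl | rfl <;> norm_num
  have hpos (i : ℕ) (hi : i < n) : 0 < (gapPolynomial n ε S).eval ((i + 1) / (n + 1) : ℝ) *
      (gapPolynomial n τ T).eval ((i + 1) / (n + 1) : ℝ) :=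
    (hc i hi).lt_of_ne' (mul_ne_zero (eval_gapPolynomial_node_ne_zero n hε0 S i)
      (eval_gapPolynomial_node_ne_zero n hτ0 T i))
  have hST : S = T := by
    ext i
    by_cases hi : i < n - 1
    · rw [mem_iff_eval_gapPolynomial_mul_neg n hε0, mem_iff_eval_gapPolynomial_mul_neg n hτ0]
      have h1 := hpos i (by omega)
      have h2 := hpos (i + 1) (by omega)
      have h3 := mul_pos h1 h2
      rw [mul_mul_mul_comm] at h3
      constructor
      · intro h4
        exact (neg_iff_neg_of_mul_pos h3).1 h4
      · intro h4
        exact (neg_iff_neg_of_mul_pos h3).2 h4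
    · exact iff_of_false (fun h => hi (Finset.mem_range.1 (hS h)))
        (fun h => hi (Finset.mem_range.1 (hT h)))
  subst hST
  have h0 := hpos 0 hn
  rw [eval_gapPolynomial_node, eval_gapPolynomial_node, mul_mul_mul_comm] at h0
  have hsq := mul_self_nonneg (∏ j ∈ S, (((0 : ℕ) : ℝ) - j - 1 / 2))
  have hετ : 0 < ε * τ := pos_of_mul_pos_left h0 hsq
  rcases hε with rfl | rfl <;> rcases hτ with rfl | rfl <;> simp at h <;> norm_num at hετ

theorem card_powerset_filter_card_lt (m k : ℕ) :
    ((Finset.range m).powerset.filter fun S => S.card < k).card =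
      ∑ j ∈ Finset.range k, m.choose j := by
  rw [Finset.card_eq_sum_card_fiberwise (f := Finset.card) (t := Finset.range k)
    (fun S hS => by simpa using (Finset.mem_filter.1 hS).2)]
  refine Finset.sum_congr rfl fun j hj => ?_
  rw [Finset.filter_filter]
  have := Finset.card_powersetCard j (Finset.range m)
  rw [Finset.card_range] at this
  rw [← this, Finset.powersetCard_eq_filter]
  congr 1
  refine Finset.filter_congr fun S _ => ?_
  have := Finset.mem_range.1 hj
  constructor
  · exact fun h => h.2
  · exact fun h => ⟨by omega, h⟩

/-- (`f(n,k) ≥ 2·∑_{j<k} C(n-1,j)` for `1 ≤ k ≤ n`.) -/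
theorem loops_lower_bound_binomial (n k : ℕ) (hn : 2 ≤ n) (hk : 1 ≤ k) (hkn : k ≤ n) :
    ∃ (A : Set ℂ) (_ : A.Finite) (_ : A.ncard = n) (x : ℂ) (hx : x ∉ A) (N : ℕ)
      (γ : Fin N → Path (X := {z : ℂ // z ∉ A}) ⟨x, hx⟩ ⟨x, hx⟩),
      2 * (∑ j ∈ Finset.range k, (n - 1).choose j) ≤ N ∧
      (∀ i j, i ≠ j → ¬ (γ i).Homotopic (γ j)) ∧
      (∀ i, AvoidsBase (γ i)) ∧
      (∀ i, SelfIntersLt (γ i) k) ∧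
      (∀ i j, i ≠ j → CrossingsLt (γ i) (γ j) k) := by
  set node : ℕ → ℝ := fun i => (i + 1) / (n + 1) with hnode
  have hnode_mem (i : ℕ) (hi : i < n) : node i ∈ Set.Ioo (0 : ℝ) 1 := by
    have : (i : ℝ) < n := by exact_mod_cast hi
    refine ⟨by positivity, (div_lt_one (by positivity)).2 (by linarith)⟩
  have hnode_inj : Function.Injective node := by
    intro i j hij
    have : (n + 1 : ℝ) ≠ 0 := by positivity
    simpa [hnode, div_left_inj' this] using hij
  have hinj : Set.InjOn (fun i => polarCurve 0 (node i)) (Finset.range n) := by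
    intro i hi j hj hij
    obtain ⟨h1, h2⟩ := hnode_mem i (by simpa using hi)
    obtain ⟨h3, h4⟩ := hnode_mem j (by simpa using hj)
    exact hnode_inj ((polarCurve_eq_iff (abs_lt.2 ⟨by linarith, by linarith⟩)).1 hij).1
  let A : Finset ℂ := (Finset.range n).image fun i => polarCurve 0 (node i)
  have hA (p : Polynomial ℝ) (hp : ∀ i < n, p.eval (node i) ≠ 0) :
      ∀ t ∈ Set.Icc (0 : ℝ) 1, polarCurve p t ∉ (A : Set ℂ) := by
    intro t ht hmem
    obtain ⟨i, hi, he⟩ := Finset.mem_image.1 (Finset.mem_coe.1 hmem)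
    rw [Finset.mem_range] at hi
    exact polarCurve_ne (hnode_mem i hi) (hp i hi) ht he.symm
  let F : Finset (ℝ × Finset ℕ) := ({1, -1} : Finset ℝ) ×ˢ
    ((Finset.range (n - 1)).powerset.filter fun S => S.card < k)
  have hε (q : F) : q.1.1 = 1 ∨ q.1.1 = -1 := by
    have := (Finset.mem_product.1 q.2).1
    simpa using this
  have hS (q : F) : q.1.2 ⊆ Finset.range (n - 1) ∧ q.1.2.card < k := by
    have := (Finset.mem_product.1 q.2).2
    simpa only [Finset.mem_filter, Finset.mem_powerset] using this
  have hε0 (q : F) : q.1.1 ≠ 0 := by rcases hε q with h | h <;> rw [h] <;> norm_num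
  let P (q : F) : Polynomial ℝ := gapPolynomial n q.1.1 q.1.2
  have hPA (q : F) := hA (P q) fun i _ => eval_gapPolynomial_node_ne_zero n (hε0 q) q.1.2 i
  have hdeg (q : F) : (P q).natDegree < k := (natDegree_gapPolynomial_le _ _ _).trans_lt (hS q).2
  have hsep (q r : F) (hqr : q ≠ r) : ∃ i < n, (P q).eval (node i) * (P r).eval (node i) < 0 :=
    exists_node_eval_mul_neg (by omega) (hε q) (hε r) (hS q).1 (hS r).1
      fun h => hqr (Subtype.ext h)
  have hx : (1 : ℂ) ∉ (A : Set ℂ) := by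
    have := hA 1 (fun i _ => by simp) 0 (by simp)
    rwa [polarCurve_zero] at this
  let e : Fin (Fintype.card F) ≃ F := (Fintype.equivFin F).symm
  refine ⟨A, A.finite_toSet, ?_, 1, hx, Fintype.card F, fun i => polarLoop (P (e i)) hx (hPA (e i)),
    ?_, fun i j hij hom => ?_, fun i => avoidsBase_polarLoop _ _ _,
    fun i => selfIntersLt_polarLoop _ _ _ hk, fun i j hij => ?_⟩
  · rw [Set.ncard_coe_finset, Finset.card_image_of_injOn hinj, Finset.card_range]
  · rw [Fintype.card_coe, Finset.card_product, card_powerset_filter_card_lt,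
      Finset.card_pair (by norm_num)]
  · obtain ⟨m, hm, hneg⟩ := hsep (e i) (e j) (e.injective.ne hij)
    have hmA : polarCurve 0 (node m) ∈ (A : Set ℂ) :=
      Finset.mem_coe.2 (Finset.mem_image_of_mem _ (Finset.mem_range.2 hm))
    rcases mul_neg_iff.1 hneg with ⟨h1, h2⟩ | ⟨h1, h2⟩
    · exact not_homotopic_polarLoop hx _ _ (hnode_mem m hm) hmA h2 h1 hom.symm
    · exact not_homotopic_polarLoop hx _ _ (hnode_mem m hm) hmA h1 h2 hom
  · refine crossingsLt_polarLoop (fun h => ?_) hx _ _ (hdeg _) (hdeg _)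
    obtain ⟨m, -, hneg⟩ := hsep (e i) (e j) (e.injective.ne hij)
    rw [h] at hneg
    exact hneg.not_ge (mul_self_nonneg _)
end
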